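/- For all natural numbers m and n, the logic NpAmn enjoys the Lyndon interpolation property (LIP): whenever NpAmn ⊢ φ → ψ, there exists a modal formula χ such that V^•(χ) ⊆ V^•(φ) ∩ V^•(ψ) for each • ∈ {+,−}, NpAmn ⊢ φ → χ, and NpAmn ⊢ χ → ψ. -/

import Mathlib

/-- Propositional formulas. -/
inductive PropForm : Type
  | var : ℕ → PropForm
  | fls : PropForm
  | and : PropForm → PropForm → PropForm
  | or : PropForm → PropForm → PropForm
  | imp : PropForm → PropForm → PropForm
  deriving DecidableEq

/-- Boolean evaluation of a propositional formula. -/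
def PropForm.eval (v : ℕ → Bool) : PropForm → Bool
  | .var i => v i
  | .fls => false
  | .and φ ψ => φ.eval v && ψ.eval v
  | .or φ ψ => φ.eval v || ψ.eval v
  | .imp φ ψ => !φ.eval v || ψ.eval v

/-- Classical propositional tautology. -/
def PropForm.Taut (φ : PropForm) : Prop := ∀ v, φ.eval v = true

/-- Modal formulas. -/
inductive ModalForm : Type
  | var : ℕ → ModalForm
  | fls : ModalForm
  | and : ModalForm → ModalForm → ModalForm
  | or : ModalForm → ModalForm → ModalForm
  | imp : ModalForm → ModalForm → ModalForm
  | box : ModalForm → ModalForm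
  deriving DecidableEq

/-- Substitution of modal formulas for the variables of a propositional formula. -/
def PropForm.subst (σ : ℕ → ModalForm) : PropForm → ModalForm
  | .var i => σ i
  | .fls => .fls
  | .and φ ψ => .and (φ.subst σ) (ψ.subst σ)
  | .or φ ψ => .or (φ.subst σ) (ψ.subst σ)
  | .imp φ ψ => .imp (φ.subst σ) (ψ.subst σ)

/-- ¬φ abbreviates φ → ⊥. -/
def ModalForm.neg (φ : ModalForm) : ModalForm := .imp φ .fls

/-- □^k φ : k-fold application of □. -/
def ModalForm.boxIter : ℕ → ModalForm → ModalForm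
  | 0, φ => φ
  | k + 1, φ => .box (ModalForm.boxIter k φ)

/-- ¬^j φ : j-fold application of ¬. -/
def ModalForm.negIter : ℕ → ModalForm → ModalForm
  | 0, φ => φ
  | k + 1, φ => (ModalForm.negIter k φ).neg

/-- φ ↔ ψ abbreviates (φ → ψ) ∧ (ψ → φ). -/
def ModalForm.iff (φ ψ : ModalForm) : ModalForm := .and (.imp φ ψ) (.imp ψ φ)

/-- Signed variables: `Vsgn φ true` is V⁺(φ), `Vsgn φ false` is V⁻(φ). -/
def ModalForm.Vsgn : ModalForm → Bool → Finset ℕ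
  | .var i, true => {i}
  | .var _, false => ∅
  | .fls, _ => ∅
  | .and φ ψ, b => φ.Vsgn b ∪ ψ.Vsgn b
  | .or φ ψ, b => φ.Vsgn b ∪ ψ.Vsgn b
  | .imp φ ψ, b => φ.Vsgn (!b) ∪ ψ.Vsgn b
  | .box φ, b => φ.Vsgn b

/-- Positive variables V⁺(φ). -/
def ModalForm.Vpos (φ : ModalForm) : Finset ℕ := φ.Vsgn true

/-- Negative variables V⁻(φ). -/
def ModalForm.Vneg (φ : ModalForm) : Finset ℕ := φ.Vsgn false

/-- All variables V(φ). -/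
def ModalForm.V (φ : ModalForm) : Finset ℕ := φ.Vpos ∪ φ.Vneg

/-- The logic NpAmn = NAmn + (Ros□ : from ¬□φ infer ¬□□φ). -/
inductive NpA (m n : ℕ) : ModalForm → Prop
  | taut (p : PropForm) (σ : ℕ → ModalForm) : p.Taut → NpA m n (p.subst σ)
  | amn (φ : ModalForm) : NpA m n (.imp (ModalForm.boxIter n φ) (ModalForm.boxIter m φ))
  | mp (φ ψ : ModalForm) : NpA m n (.imp φ ψ) → NpA m n φ → NpA m n ψ
  | nec (φ : ModalForm) : NpA m n φ → NpA m n (.box φ)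
  | rosbox (φ : ModalForm) : NpA m n (ModalForm.neg (.box φ)) →
      NpA m n (ModalForm.neg (.box (.box φ)))

namespace ModalForm

instance : Inhabited ModalForm := ⟨.fls⟩

/-- Truth of a modal formula, read as a Boolean combination of variables and boxed formulas, under
an assignment `g` of truth values to these. -/
def Holds (g : ModalForm → Prop) : ModalForm → Prop
  | .var i => g (.var i)
  | .fls => False
  | .and φ ψ => φ.Holds g ∧ ψ.Holds g
  | .or φ ψ => φ.Holds g ∨ ψ.Holds g
  | .imp φ ψ => φ.Holds g → ψ.Holds g
  | .box φ => g (.box φ)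

/-- An injective numbering of modal formulas. -/
def code : ModalForm → ℕ
  | .var i => Nat.pair 0 i
  | .fls => Nat.pair 1 0
  | .and φ ψ => Nat.pair 2 (Nat.pair φ.code ψ.code)
  | .or φ ψ => Nat.pair 3 (Nat.pair φ.code ψ.code)
  | .imp φ ψ => Nat.pair 4 (Nat.pair φ.code ψ.code)
  | .box φ => Nat.pair 5 φ.code

theorem code_injective : Function.Injective code := by
  intro φ
  induction φ with
  | var i => intro ψ h; cases ψ <;> simp_all [code, Nat.pair_eq_pair]
  | fls => intro ψ h; cases ψ <;> simp_all [code, Nat.pair_eq_pair]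
  | and φ₁ φ₂ ih₁ ih₂ =>
    intro ψ h
    cases ψ <;> simp [code, Nat.pair_eq_pair] at h ⊢
    exact ⟨ih₁ h.1, ih₂ h.2⟩
  | or φ₁ φ₂ ih₁ ih₂ =>
    intro ψ h
    cases ψ <;> simp [code, Nat.pair_eq_pair] at h ⊢
    exact ⟨ih₁ h.1, ih₂ h.2⟩
  | imp φ₁ φ₂ ih₁ ih₂ =>
    intro ψ h
    cases ψ <;> simp [code, Nat.pair_eq_pair] at h ⊢
    exact ⟨ih₁ h.1, ih₂ h.2⟩
  | box φ ih =>
    intro ψ h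
    cases ψ <;> simp [code, Nat.pair_eq_pair] at h ⊢
    exact ih h

/-- The propositional skeleton of a modal formula. -/
def skeleton : ModalForm → PropForm
  | .var i => .var (code (.var i))
  | .fls => .fls
  | .and φ ψ => .and φ.skeleton ψ.skeleton
  | .or φ ψ => .or φ.skeleton ψ.skeleton
  | .imp φ ψ => .imp φ.skeleton ψ.skeleton
  | .box φ => .var (code (.box φ))

theorem subst_skeleton {σ : ℕ → ModalForm} (hσ : ∀ φ, σ (code φ) = φ) (φ : ModalForm) :
    φ.skeleton.subst σ = φ := by
  induction φ <;> simp_all [skeleton, PropForm.subst]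

theorem eval_skeleton (v : ℕ → Bool) (φ : ModalForm) :
    φ.skeleton.eval v = true ↔ φ.Holds fun α => v α.code = true := by
  induction φ with
  | imp φ ψ ih₁ ih₂ =>
    simp only [skeleton, PropForm.eval, Holds, ← ih₁, ← ih₂]
    cases φ.skeleton.eval v <;> simp
  | _ => simp_all [skeleton, PropForm.eval, Holds]

theorem holds_subst (g : ModalForm → Prop) [DecidablePred fun α : ModalForm => α.Holds g]
    (σ : ℕ → ModalForm) (p : PropForm) :
    (p.subst σ).Holds g ↔ p.eval (fun i => decide ((σ i).Holds g)) = true := by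
  induction p with
  | imp p q ih₁ ih₂ =>
    simp only [PropForm.subst, PropForm.eval, Holds, ih₁, ih₂]
    cases p.eval (fun i => decide ((σ i).Holds g)) <;> simp
  | _ => simp_all [PropForm.subst, PropForm.eval, Holds]

theorem holds_subst_of_taut {p : PropForm} (hp : p.Taut) (g : ModalForm → Prop)
    (σ : ℕ → ModalForm) : (p.subst σ).Holds g := by
  classical exact (holds_subst g σ p).2 (hp _)

/-- The variables and boxed formulas of which a modal formula is a Boolean combination, with the
sign of their occurrences. -/
def atoms : ModalForm → Bool → List ModalForm
  | .var i, b => if b then [.var i] else []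
  | .fls, _ => []
  | .and φ ψ, b => φ.atoms b ++ ψ.atoms b
  | .or φ ψ, b => φ.atoms b ++ ψ.atoms b
  | .imp φ ψ, b => φ.atoms (!b) ++ ψ.atoms b
  | .box φ, b => if b then [.box φ] else []

theorem Vsgn_subset_of_mem_atoms {α φ : ModalForm} {s : Bool} (h : α ∈ φ.atoms s) (b : Bool) :
    α.Vsgn b ⊆ φ.Vsgn (b == s) := by
  induction φ generalizing s with
  | var i => cases s <;> simp_all [atoms]
  | fls => simp [atoms] at h
  | box φ => cases s <;> simp_all [atoms]
  | and φ ψ ih₁ ih₂ =>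
    simp only [atoms, List.mem_append] at h
    rcases h with h | h
    · exact (ih₁ h).trans Finset.subset_union_left
    · exact (ih₂ h).trans Finset.subset_union_right
  | or φ ψ ih₁ ih₂ =>
    simp only [atoms, List.mem_append] at h
    rcases h with h | h
    · exact (ih₁ h).trans Finset.subset_union_left
    · exact (ih₂ h).trans Finset.subset_union_right
  | imp φ ψ ih₁ ih₂ =>
    simp only [atoms, List.mem_append] at h
    rcases h with h | h
    · have hb : (b == !s) = !(b == s) := by cases b <;> cases s <;> rfl
      exact (hb ▸ ih₁ h).trans Finset.subset_union_left
    · exact (ih₂ h).trans Finset.subset_union_right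

theorem Holds.mono {g h : ModalForm → Prop} {φ : ModalForm}
    (hpos : ∀ α ∈ φ.atoms true, g α → h α) (hneg : ∀ α ∈ φ.atoms false, h α → g α)
    (H : φ.Holds g) : φ.Holds h := by
  induction φ generalizing g h with
  | var i => exact hpos _ (by simp [atoms]) H
  | fls => exact H
  | box φ => exact hpos _ (by simp [atoms]) H
  | and φ ψ ih₁ ih₂ =>
    simp only [atoms, List.mem_append] at hpos hneg
    exact ⟨ih₁ (fun α hα => hpos α (.inl hα)) (fun α hα => hneg α (.inl hα)) H.1,
      ih₂ (fun α hα => hpos α (.inr hα)) (fun α hα => hneg α (.inr hα)) H.2⟩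
  | or φ ψ ih₁ ih₂ =>
    simp only [atoms, List.mem_append] at hpos hneg
    exact H.imp (ih₁ (fun α hα => hpos α (.inl hα)) (fun α hα => hneg α (.inl hα)))
      (ih₂ (fun α hα => hpos α (.inr hα)) (fun α hα => hneg α (.inr hα)))
  | imp φ ψ ih₁ ih₂ =>
    simp only [atoms, List.mem_append] at hpos hneg
    exact fun hφ => ih₂ (fun α hα => hpos α (.inr hα)) (fun α hα => hneg α (.inr hα))
      (H (ih₁ (fun α hα => hneg α (.inl hα)) (fun α hα => hpos α (.inl hα)) hφ))

/-- The truth constant. -/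
def tru : ModalForm := .imp .fls .fls

/-- Conjunction of a list of formulas. -/
def conj : List ModalForm → ModalForm
  | [] => tru
  | φ :: l => .and φ (conj l)

/-- Disjunction of a list of formulas. -/
def disj : List ModalForm → ModalForm
  | [] => .fls
  | φ :: l => .or φ (disj l)

theorem holds_conj {g : ModalForm → Prop} {l : List ModalForm} :
    (conj l).Holds g ↔ ∀ φ ∈ l, φ.Holds g := by
  induction l <;> simp_all [conj, tru, Holds]

theorem holds_disj {g : ModalForm → Prop} {l : List ModalForm} :
    (disj l).Holds g ↔ ∃ φ ∈ l, φ.Holds g := by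
  induction l <;> simp_all [disj, Holds]

theorem Vsgn_tru (b : Bool) : tru.Vsgn b = ∅ := by simp [tru, Vsgn]

theorem Vsgn_conj_subset {l : List ModalForm} {b : Bool} {S : Finset ℕ}
    (h : ∀ φ ∈ l, φ.Vsgn b ⊆ S) : (conj l).Vsgn b ⊆ S := by
  induction l with
  | nil => simp [conj, Vsgn_tru]
  | cons φ l ih =>
    exact Finset.union_subset (h _ (by simp)) (ih fun ψ hψ => h ψ (by simp [hψ]))

theorem Vsgn_disj_subset {l : List ModalForm} {b : Bool} {S : Finset ℕ}
    (h : ∀ φ ∈ l, φ.Vsgn b ⊆ S) : (disj l).Vsgn b ⊆ S := by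
  induction l with
  | nil => simp [disj, Vsgn]
  | cons φ l ih =>
    exact Finset.union_subset (h _ (by simp)) (ih fun ψ hψ => h ψ (by simp [hψ]))

theorem holds_of_mem_atoms {g : ModalForm → Prop} {α φ : ModalForm} {s : Bool}
    (h : α ∈ φ.atoms s) : α.Holds g ↔ g α := by
  induction φ generalizing s with
  | var i => cases s <;> simp_all [atoms, Holds]
  | fls => simp [atoms] at h
  | box φ => cases s <;> simp_all [atoms, Holds]
  | and φ ψ ih₁ ih₂ => exact (List.mem_append.1 h).elim ih₁ ih₂
  | or φ ψ ih₁ ih₂ => exact (List.mem_append.1 h).elim ih₁ ih₂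
  | imp φ ψ ih₁ ih₂ => exact (List.mem_append.1 h).elim ih₁ ih₂

/-- If every common positive atom of `φ` and `ψ` true in `s` is true in `g`, and every common
negative atom false in `s` is false in `g`, then an assignment exists which `φ` cannot tell from `s`
and `ψ` cannot tell from `g`. -/
theorem exists_amalgam {φ ψ : ModalForm} {s g : ModalForm → Prop}
    (hpos : ∀ α, α ∈ φ.atoms true → α ∈ ψ.atoms true → s α → g α)
    (hneg : ∀ α, α ∈ φ.atoms false → α ∈ ψ.atoms false → g α → s α) :
    ∃ h : ModalForm → Prop, (φ.Holds s → φ.Holds h) ∧ (ψ.Holds h → ψ.Holds g) := by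
  refine ⟨fun α => (s α ∧ g α) ∨ (s α ∧ α ∈ φ.atoms true) ∨
    (g α ∧ α ∉ φ.atoms false), Holds.mono ?_ ?_, Holds.mono ?_ ?_⟩
  · intro α h1 h2
    tauto
  · intro α h1 h2
    tauto
  · intro α h1 h2
    have := hpos α
    tauto
  · intro α h1 h2
    have := hneg α
    tauto

/-- Lyndon interpolation for classical propositional logic, over variables and boxed formulas. -/
theorem exists_interpolant_of_holds {φ ψ : ModalForm}
    (h : ∀ g : ModalForm → Prop, φ.Holds g → ψ.Holds g) :
    ∃ χ : ModalForm, (∀ b, χ.Vsgn b ⊆ φ.Vsgn b ∩ ψ.Vsgn b) ∧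
      (∀ g, φ.Holds g → χ.Holds g) ∧ (∀ g, χ.Holds g → ψ.Holds g) := by
  classical
  let P := (φ.atoms true).filter (· ∈ ψ.atoms true)
  let N := (φ.atoms false).filter (· ∈ ψ.atoms false)
  let lits := P ++ N.map neg
  let D := lits.sublists.filter fun l => ∀ g, (conj l).Holds g → ψ.Holds g
  have hlits : ∀ α ∈ lits, ∀ b, α.Vsgn b ⊆ φ.Vsgn b ∩ ψ.Vsgn b := by
    intro α hα b
    simp only [lits, P, N, List.mem_append, List.mem_filter, List.mem_map, decide_eq_true_eq] at hα
    rcases hα with ⟨h1, h2⟩ | ⟨β, ⟨h1, h2⟩, rfl⟩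
    · have h3 := Vsgn_subset_of_mem_atoms h1 b
      have h4 := Vsgn_subset_of_mem_atoms h2 b
      rw [beq_true] at h3 h4
      exact Finset.subset_inter h3 h4
    · have h3 := Vsgn_subset_of_mem_atoms h1 (!b)
      have h4 := Vsgn_subset_of_mem_atoms h2 (!b)
      rw [beq_false, Bool.not_not] at h3 h4
      simpa [neg, Vsgn] using Finset.subset_inter h3 h4
  refine ⟨disj (D.map conj), fun b => Vsgn_disj_subset ?_, fun s hs => ?_, fun g hg => ?_⟩
  · intro δ hδ
    obtain ⟨l, hl, rfl⟩ := List.mem_map.1 hδ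
    have hl' := List.mem_sublists.1 (List.mem_filter.1 hl).1
    exact Vsgn_conj_subset fun α hα => hlits α (hl'.subset hα) b
  · have hl : (lits.filter fun α => α.Holds s) ∈ D := by
      refine List.mem_filter.2 ⟨List.mem_sublists.2 List.filter_sublist, ?_⟩
      rw [decide_eq_true_eq]
      intro g hg
      rw [holds_conj] at hg
      obtain ⟨k, hk₁, hk₂⟩ := exists_amalgam (φ := φ) (ψ := ψ) (s := s) (g := g)
        (fun α h1 h2 h3 => (holds_of_mem_atoms h1).1 (hg α (by
          simp [lits, P, h1, h2, (holds_of_mem_atoms h1).2 h3])))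
        (fun α h1 h2 h3 => by
          by_contra h4
          have h5 : (neg α).Holds s := fun h => h4 ((holds_of_mem_atoms h1).1 h)
          exact hg (neg α) (List.mem_filter.2 ⟨List.mem_append_right _ (List.mem_map_of_mem (by
            simp [N, h1, h2])), by simpa using h5⟩) ((holds_of_mem_atoms h1).2 h3))
      exact hk₂ (h k (hk₁ hs))
    refine holds_disj.2 ⟨_, List.mem_map_of_mem hl, holds_conj.2 fun α hα => ?_⟩
    simpa using (List.mem_filter.1 hα).2
  · obtain ⟨δ, hδ, hδg⟩ := holds_disj.1 hg
    obtain ⟨l, hl, rfl⟩ := List.mem_map.1 hδ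
    exact of_decide_eq_true (List.mem_filter.1 hl).2 g hδg

/-- Removal of `k` leading boxes. -/
def strip : ℕ → ModalForm → Option ModalForm
  | 0, φ => some φ
  | k + 1, .box φ => strip k φ
  | _ + 1, _ => none

theorem strip_boxIter (k : ℕ) (φ : ModalForm) : strip k (boxIter k φ) = some φ := by
  induction k with
  | zero => rfl
  | succ k ih => simpa [boxIter, strip] using ih

theorem eq_boxIter_of_strip {k : ℕ} {φ χ : ModalForm} (h : strip k φ = some χ) :
    φ = boxIter k χ := by
  induction k generalizing φ with
  | zero => simpa [strip, boxIter] using h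
  | succ k ih =>
    cases φ <;> simp [strip, boxIter] at h ⊢
    exact ih h

theorem boxIter_add (j k : ℕ) (φ : ModalForm) :
    boxIter (j + k) φ = boxIter j (boxIter k φ) := by
  induction j with
  | zero => simp [boxIter]
  | succ j ih => rw [Nat.succ_add, boxIter, ih, boxIter]

theorem sizeOf_boxIter (k : ℕ) (φ : ModalForm) : sizeOf (boxIter k φ) = k + sizeOf φ := by
  induction k with
  | zero => simp [boxIter]
  | succ k ih => simp [boxIter, ih]; omega

theorem Vsgn_boxIter (k : ℕ) (φ : ModalForm) (b : Bool) : (boxIter k φ).Vsgn b = φ.Vsgn b := by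
  induction k with
  | zero => rfl
  | succ k ih => simpa [boxIter, Vsgn] using ih

/-- Rewriting of `□^a χ` to `□^b χ`, where `b < a`. -/
def shorten (a b : ℕ) (φ : ModalForm) : Option ModalForm :=
  if b < a then (strip a φ).map (boxIter b) else none

theorem shorten_boxIter {a b : ℕ} (h : b < a) (χ : ModalForm) :
    shorten a b (boxIter a χ) = some (boxIter b χ) := by
  simp [shorten, h, strip_boxIter]

theorem exists_of_shorten {a b : ℕ} {φ ψ : ModalForm} (h : shorten a b φ = some ψ) :
    b < a ∧ ∃ χ, φ = boxIter a χ ∧ ψ = boxIter b χ := by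
  unfold shorten at h
  split at h
  · obtain ⟨χ, h1, rfl⟩ := Option.map_eq_some_iff.1 h
    exact ⟨‹_›, χ, eq_boxIter_of_strip h1, rfl⟩
  · cases h

theorem sizeOf_lt_of_shorten {a b : ℕ} {φ ψ : ModalForm} (h : shorten a b φ = some ψ) :
    sizeOf ψ < sizeOf φ := by
  obtain ⟨hab, χ, rfl, rfl⟩ := exists_of_shorten h
  simp only [sizeOf_boxIter]
  omega

/-- Replace each outermost boxed formula `β` by `op (G β) β'`, where `β'` is the translation of the
formula to which `β` can be shortened, or by `G β` when there is none. -/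
def boxTranslate (op : ModalForm → ModalForm → ModalForm) (G : ModalForm → ModalForm) (a b : ℕ) :
    ModalForm → ModalForm
  | .var i => .var i
  | .fls => .fls
  | .and φ ψ => .and (boxTranslate op G a b φ) (boxTranslate op G a b ψ)
  | .or φ ψ => .or (boxTranslate op G a b φ) (boxTranslate op G a b ψ)
  | .imp φ ψ => .imp (boxTranslate op G a b φ) (boxTranslate op G a b ψ)
  | .box φ =>
    match _h : shorten a b (.box φ) with
    | none => G (.box φ)
    | some χ => op (G (.box φ)) (boxTranslate op G a b χ)
termination_by φ => sizeOf φ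
decreasing_by
  all_goals first
    | exact sizeOf_lt_of_shorten _h
    | (simp; try omega)

theorem boxTranslate_box_of_none {op : ModalForm → ModalForm → ModalForm}
    {G : ModalForm → ModalForm} {a b : ℕ} {φ : ModalForm}
    (h : shorten a b (.box φ) = none) : boxTranslate op G a b (.box φ) = G (.box φ) := by
  rw [boxTranslate]
  split <;> simp_all

theorem boxTranslate_box_of_some {op : ModalForm → ModalForm → ModalForm}
    {G : ModalForm → ModalForm} {a b : ℕ} {φ χ : ModalForm}
    (h : shorten a b (.box φ) = some χ) :
    boxTranslate op G a b (.box φ) = op (G (.box φ)) (boxTranslate op G a b χ) := by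
  rw [boxTranslate]
  split <;> simp_all

/-- An induction principle following the recursion of `boxTranslate`. -/
theorem induction_shorten (a b : ℕ) {P : ModalForm → Prop} (var : ∀ i, P (.var i)) (fls : P .fls)
    (and : ∀ φ ψ, P φ → P ψ → P (.and φ ψ)) (or : ∀ φ ψ, P φ → P ψ → P (.or φ ψ))
    (imp : ∀ φ ψ, P φ → P ψ → P (.imp φ ψ))
    (box_none : ∀ φ, shorten a b (.box φ) = none → P (.box φ))
    (box_some : ∀ φ χ, shorten a b (.box φ) = some χ → P χ → P (.box φ)) (φ : ModalForm) :
    P φ := by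
  induction hs : sizeOf φ using Nat.strong_induction_on generalizing φ with
  | _ s ih =>
    subst hs
    cases φ with
    | var i => exact var i
    | fls => exact fls
    | and φ ψ =>
      exact and φ ψ (ih _ (by simp; omega) _ rfl) (ih _ (by simp) _ rfl)
    | or φ ψ =>
      exact or φ ψ (ih _ (by simp; omega) _ rfl) (ih _ (by simp) _ rfl)
    | imp φ ψ =>
      exact imp φ ψ (ih _ (by simp; omega) _ rfl) (ih _ (by simp) _ rfl)
    | box φ =>
      cases h : shorten a b (.box φ) with
      | none => exact box_none φ h
      | some χ => exact box_some φ χ h (ih _ (sizeOf_lt_of_shorten h) _ rfl)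

theorem Vsgn_boxTranslate_subset {op : ModalForm → ModalForm → ModalForm}
    {G : ModalForm → ModalForm} (hop : ∀ φ ψ b, (op φ ψ).Vsgn b = φ.Vsgn b ∪ ψ.Vsgn b)
    (hG : ∀ φ b, (G φ).Vsgn b ⊆ φ.Vsgn b) (a c : ℕ) (φ : ModalForm) (b : Bool) :
    (boxTranslate op G a c φ).Vsgn b ⊆ φ.Vsgn b := by
  induction φ using induction_shorten a c generalizing b with
  | var i => rw [boxTranslate]
  | fls => rw [boxTranslate]
  | and φ ψ ih₁ ih₂ => rw [boxTranslate]; exact Finset.union_subset_union (ih₁ b) (ih₂ b)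
  | or φ ψ ih₁ ih₂ => rw [boxTranslate]; exact Finset.union_subset_union (ih₁ b) (ih₂ b)
  | imp φ ψ ih₁ ih₂ => rw [boxTranslate]; exact Finset.union_subset_union (ih₁ (!b)) (ih₂ b)
  | box_none φ h => rw [boxTranslate_box_of_none h]; exact hG _ b
  | box_some φ χ h ih =>
    rw [boxTranslate_box_of_some h, hop]
    refine Finset.union_subset (hG _ b) ((ih b).trans ?_)
    obtain ⟨-, ρ, h1, rfl⟩ := exists_of_shorten h
    rw [h1, Vsgn_boxIter, Vsgn_boxIter]

theorem holds_boxTranslate (op : ModalForm → ModalForm → ModalForm) (G : ModalForm → ModalForm)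
    (a b : ℕ) (g : ModalForm → Prop) (φ : ModalForm) :
    (boxTranslate op G a b φ).Holds g ↔ φ.Holds fun α => (boxTranslate op G a b α).Holds g := by
  induction φ with
  | var i => simp [Holds]
  | box φ => simp [Holds]
  | _ => rw [boxTranslate]; simp_all [Holds]

end ModalForm

namespace NpA

open ModalForm

variable {m n : ℕ}

theorem of_holds {φ : ModalForm} (h : ∀ g, φ.Holds g) : NpA m n φ := by
  have hσ : ∀ ψ, Function.invFun code (code ψ) = ψ :=
    Function.leftInverse_invFun code_injective
  rw [← subst_skeleton hσ φ]
  exact .taut _ _ fun v => (eval_skeleton v φ).2 (h _)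

theorem of_holds₁ {φ ψ : ModalForm} (hφ : NpA m n φ) (h : ∀ g, φ.Holds g → ψ.Holds g) :
    NpA m n ψ :=
  .mp φ ψ (of_holds h) hφ

theorem of_holds₂ {φ ψ χ : ModalForm} (hφ : NpA m n φ) (hψ : NpA m n ψ)
    (h : ∀ g, φ.Holds g → ψ.Holds g → χ.Holds g) : NpA m n χ :=
  .mp ψ χ (.mp φ (.imp ψ χ) (of_holds h) hφ) hψ

theorem of_holds₃ {φ ψ χ θ : ModalForm} (hφ : NpA m n φ) (hψ : NpA m n ψ) (hχ : NpA m n χ)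
    (h : ∀ g, φ.Holds g → ψ.Holds g → χ.Holds g → θ.Holds g) : NpA m n θ :=
  .mp χ θ (of_holds₂ hφ hψ (χ := .imp χ θ) h) hχ

open Classical in
/-- Replace a provable formula by truth and a refutable one by falsity. -/
noncomputable def settle (m n : ℕ) (φ : ModalForm) : ModalForm :=
  if NpA m n φ then tru else if NpA m n φ.neg then .fls else φ

theorem Vsgn_settle_subset (φ : ModalForm) (b : Bool) : (settle m n φ).Vsgn b ⊆ φ.Vsgn b := by
  unfold settle
  split_ifs
  · simp [Vsgn_tru]
  · simp [Vsgn]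
  · rfl

theorem iff_settle (φ : ModalForm) : NpA m n (φ.iff (settle m n φ)) := by
  unfold settle
  split_ifs with h1 h2
  · exact of_holds₁ h1 fun g h => by simp_all [ModalForm.iff, Holds, tru]
  · exact of_holds₁ h2 fun g h => by simp_all [ModalForm.iff, ModalForm.neg, Holds]
  · exact of_holds fun g => by simp [ModalForm.iff, Holds]

theorem holds_settle {φ : ModalForm} (h : NpA m n φ) (g : ModalForm → Prop) :
    (settle m n φ).Holds g := by
  simp [settle, h, tru, Holds]

theorem not_holds_settle (hcon : ¬ NpA m n .fls) {φ : ModalForm} (h : NpA m n φ.neg)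
    (g : ModalForm → Prop) : ¬ (settle m n φ).Holds g := by
  have h1 : ¬ NpA m n φ := fun h' => hcon (.mp _ _ h h')
  simp [settle, h, h1, Holds]

theorem iff_boxTranslate {op : ModalForm → ModalForm → ModalForm} {G : ModalForm → ModalForm}
    {a b : ℕ}
    (hop : ∀ φ χ γ δ : ModalForm, shorten a b φ = some χ → NpA m n (φ.iff γ) → NpA m n (χ.iff δ) →
      NpA m n (φ.iff (op γ δ)))
    (hG : ∀ φ : ModalForm, NpA m n (φ.iff (G φ))) (φ : ModalForm) :
    NpA m n (φ.iff (boxTranslate op G a b φ)) := by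
  induction φ using induction_shorten a b with
  | var i => rw [boxTranslate]; exact of_holds fun g => by simp [ModalForm.iff, Holds]
  | fls => rw [boxTranslate]; exact of_holds fun g => by simp [ModalForm.iff, Holds]
  | and φ ψ ih₁ ih₂ =>
    rw [boxTranslate]
    exact of_holds₂ ih₁ ih₂ fun g => by simp only [ModalForm.iff, Holds]; tauto
  | or φ ψ ih₁ ih₂ =>
    rw [boxTranslate]
    exact of_holds₂ ih₁ ih₂ fun g => by simp only [ModalForm.iff, Holds]; tauto
  | imp φ ψ ih₁ ih₂ =>
    rw [boxTranslate]
    exact of_holds₂ ih₁ ih₂ fun g => by simp only [ModalForm.iff, Holds]; tauto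
  | box_none φ h => rw [boxTranslate_box_of_none h]; exact hG _
  | box_some φ χ h ih => rw [boxTranslate_box_of_some h]; exact hop _ _ _ _ h (hG _) ih

/-- A translation which preserves formulas up to provable equivalence and turns theorems into
tautologies yields Lyndon interpolants. -/
theorem exists_interpolant_of_translation {T : ModalForm → ModalForm}
    (hV : ∀ φ b, (T φ).Vsgn b ⊆ φ.Vsgn b) (hT : ∀ φ : ModalForm, NpA m n (φ.iff (T φ)))
    {φ ψ : ModalForm} (h : ∀ g, (T φ).Holds g → (T ψ).Holds g) :
    ∃ χ : ModalForm, χ.Vpos ⊆ φ.Vpos ∩ ψ.Vpos ∧ χ.Vneg ⊆ φ.Vneg ∩ ψ.Vneg ∧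
      NpA m n (.imp φ χ) ∧ NpA m n (.imp χ ψ) := by
  obtain ⟨χ, h1, h2, h3⟩ := exists_interpolant_of_holds h
  have hχ : ∀ b, χ.Vsgn b ⊆ φ.Vsgn b ∩ ψ.Vsgn b := fun b =>
    (h1 b).trans (Finset.inter_subset_inter (hV φ b) (hV ψ b))
  refine ⟨χ, hχ true, hχ false, of_holds₁ (hT φ) fun g hg hφ => h2 g (hg.1 hφ),
    of_holds₁ (hT ψ) fun g hg hψ => hg.2 (h3 g hψ)⟩

theorem holds_true_of_le (hnm : n ≤ m) {φ : ModalForm} (h : NpA m n φ) :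
    φ.Holds fun _ => True := by
  induction h with
  | taut p σ hp => exact holds_subst_of_taut hp _ σ
  | amn φ =>
    intro h
    cases m with
    | zero => rwa [Nat.le_zero.1 hnm] at h
    | succ m => trivial
  | mp φ ψ _ _ ih₁ ih₂ => exact ih₁ ih₂
  | nec φ _ _ => trivial
  | rosbox φ _ ih => exact (ih trivial).elim

theorem holds_boxTranslate_of_le (hnm : n ≤ m) {φ : ModalForm} (h : NpA m n φ)
    (g : ModalForm → Prop) : (boxTranslate .or (settle m n) m n φ).Holds g := by
  induction h with
  | taut p σ hp => rw [holds_boxTranslate]; exact holds_subst_of_taut hp _ σ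
  | amn φ =>
    rw [boxTranslate]
    intro h
    rcases hnm.eq_or_lt with rfl | hlt
    · exact h
    · obtain ⟨k, rfl⟩ : ∃ k, m = k + 1 := ⟨m - 1, by omega⟩
      rw [boxIter, boxTranslate_box_of_some (shorten_boxIter hlt φ)]
      exact .inr h
  | mp φ ψ _ _ ih₁ ih₂ => rw [boxTranslate] at ih₁; exact ih₁ ih₂
  | nec φ hφ _ =>
    have h1 := holds_settle (NpA.nec φ hφ) g
    cases hs : shorten m n (.box φ) with
    | none => rwa [boxTranslate_box_of_none hs]
    | some χ => rw [boxTranslate_box_of_some hs]; exact .inl h1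
  | rosbox φ h _ => exact (holds_true_of_le hnm h trivial).elim

/-- Derivability in `NpA` with at most `k` nested uses of the rules for the box. -/
inductive Stage (m n : ℕ) : ℕ → ModalForm → Prop
  | taut (k : ℕ) (p : PropForm) (σ : ℕ → ModalForm) : p.Taut → Stage m n k (p.subst σ)
  | amn (k : ℕ) (φ : ModalForm) :
      Stage m n k (.imp (ModalForm.boxIter n φ) (ModalForm.boxIter m φ))
  | mp (k : ℕ) (φ ψ : ModalForm) : Stage m n k (.imp φ ψ) → Stage m n k φ → Stage m n k ψ
  | nec (k : ℕ) (φ : ModalForm) : Stage m n k φ → Stage m n (k + 1) (.box φ)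
  | rosbox (k : ℕ) (φ : ModalForm) : Stage m n k (ModalForm.neg (.box φ)) →
      Stage m n (k + 1) (ModalForm.neg (.box (.box φ)))

theorem Stage.toNpA {k : ℕ} {φ : ModalForm} (h : Stage m n k φ) : NpA m n φ := by
  induction h with
  | taut k p σ hp => exact .taut p σ hp
  | amn k φ => exact .amn φ
  | mp k φ ψ _ _ ih₁ ih₂ => exact .mp φ ψ ih₁ ih₂
  | nec k φ _ ih => exact .nec φ ih
  | rosbox k φ _ ih => exact .rosbox φ ih

theorem Stage.succ {k : ℕ} {φ : ModalForm} (h : Stage m n k φ) : Stage m n (k + 1) φ := by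
  induction h with
  | taut k p σ hp => exact .taut _ p σ hp
  | amn k φ => exact .amn _ φ
  | mp k φ ψ _ _ ih₁ ih₂ => exact .mp _ φ ψ ih₁ ih₂
  | nec k φ _ ih => exact .nec _ φ ih
  | rosbox k φ _ ih => exact .rosbox _ φ ih

theorem Stage.mono {j k : ℕ} (hjk : j ≤ k) {φ : ModalForm} (h : Stage m n j φ) :
    Stage m n k φ := by
  induction hjk with
  | refl => exact h
  | step _ ih => exact ih.succ

theorem exists_stage {φ : ModalForm} (h : NpA m n φ) : ∃ k, Stage m n k φ := by
  induction h with
  | taut p σ hp => exact ⟨0, .taut _ p σ hp⟩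
  | amn φ => exact ⟨0, .amn _ φ⟩
  | mp φ ψ _ _ ih₁ ih₂ =>
    obtain ⟨j, hj⟩ := ih₁
    obtain ⟨k, hk⟩ := ih₂
    exact ⟨max j k, .mp _ φ ψ (hj.mono (le_max_left _ _)) (hk.mono (le_max_right _ _))⟩
  | nec φ _ ih => exact ih.imp' (· + 1) fun k => .nec k φ
  | rosbox φ _ ih => exact ih.imp' (· + 1) fun k => .rosbox k φ

theorem Stage.of_boxIter {k : ℕ}
    (hA : ∀ j ≤ k, ∀ β, Stage m n j (.box β) → ∃ i < j, Stage m n i β) (t : ℕ)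
    {χ : ModalForm} (h : Stage m n k (boxIter t χ)) : Stage m n k χ := by
  induction t with
  | zero => exact h
  | succ t ih =>
    obtain ⟨i, hi, h'⟩ := hA k le_rfl _ h
    exact ih (h'.mono hi.le)

theorem Stage.holds_boxTranslate_of_lt (hmn : m < n) {k : ℕ}
    (hA : ∀ j < k, ∀ β, Stage m n j (.box β) → ∃ i < j, Stage m n i β)
    {G : ModalForm → ModalForm} {g : ModalForm → Prop}
    (hnec : ∀ j < k, ∀ β, Stage m n j β → (G (.box β)).Holds g)
    (hros : ∀ j < k, ∀ β, Stage m n j (neg (.box β)) → ¬ (G (.box (.box β))).Holds g)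
    {φ : ModalForm} (h : Stage m n k φ) : (boxTranslate .and G n m φ).Holds g := by
  induction k using Nat.strong_induction_on generalizing φ with
  | _ k ih =>
    induction h with
    | taut k p σ hp => rw [holds_boxTranslate]; exact holds_subst_of_taut hp _ σ
    | amn k φ =>
      rw [boxTranslate]
      intro h
      obtain ⟨t, rfl⟩ : ∃ t, n = t + 1 := ⟨n - 1, by omega⟩
      rw [boxIter, boxTranslate_box_of_some (shorten_boxIter hmn φ)] at h
      exact h.2
    | mp k φ ψ _ _ ih₁ ih₂ =>
      have h1 := ih₁ ih hA hnec hros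
      rw [boxTranslate] at h1
      exact h1 (ih₂ ih hA hnec hros)
    | nec k φ h _ =>
      have h1 := hnec k k.lt_succ_self φ h
      cases hs : shorten n m (.box φ) with
      | none => rwa [boxTranslate_box_of_none hs]
      | some χ =>
        rw [boxTranslate_box_of_some hs]
        refine ⟨h1, ?_⟩
        obtain ⟨-, ρ, h2, rfl⟩ := exists_of_shorten hs
        obtain ⟨t, rfl⟩ : ∃ t, n = (t + m) + 1 := ⟨n - 1 - m, by omega⟩
        rw [boxIter, ModalForm.box.injEq, boxIter_add] at h2
        subst h2
        exact ih k k.lt_succ_self (fun j hj => hA j (hj.trans k.lt_succ_self))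
          (fun j hj => hnec j (hj.trans k.lt_succ_self))
          (fun j hj => hros j (hj.trans k.lt_succ_self))
          (Stage.of_boxIter (fun j hj => hA j (Nat.lt_succ_of_le hj)) t h)
    | rosbox k φ h _ =>
      have h1 := hros k k.lt_succ_self φ h
      rw [neg, boxTranslate, boxTranslate]
      intro h2
      cases hs : shorten n m (.box (.box φ)) with
      | none => rw [boxTranslate_box_of_none hs] at h2; exact h1 h2
      | some χ => rw [boxTranslate_box_of_some hs] at h2; exact h1 h2.1

theorem Stage.exists_lt_of_box (hmn : m < n) (hcon : ¬ NpA m n .fls) (k : ℕ) :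
    ∀ β, Stage m n k (.box β) → ∃ j < k, Stage m n j β := by
  classical
  induction k using Nat.strong_induction_on with
  | _ k hA =>
    intro β hβ
    let G : ModalForm → ModalForm := fun α =>
      if ∃ γ, α = .box γ ∧ ∃ j < k, Stage m n j γ then tru else .fls
    have hG : ∀ γ g, (G (.box γ)).Holds g ↔ ∃ j < k, Stage m n j γ := by
      intro γ g
      by_cases h : ∃ j < k, Stage m n j γ <;> simp [G, h, tru, Holds]
    have h1 := Stage.holds_boxTranslate_of_lt hmn hA (G := G) (g := fun _ => True)
      (fun j hj γ hγ => (hG γ _).2 ⟨j, hj, hγ⟩)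
      (fun j hj γ hγ h => by
        obtain ⟨i, -, hi⟩ := (hG _ _).1 h
        exact hcon (.mp _ _ hγ.toNpA hi.toNpA)) hβ
    refine (hG β fun _ => True).1 ?_
    cases hs : shorten n m (.box β) with
    | none => rwa [boxTranslate_box_of_none hs] at h1
    | some χ => rw [boxTranslate_box_of_some hs] at h1; exact h1.1

theorem holds_boxTranslate_of_lt (hmn : m < n) (hcon : ¬ NpA m n .fls) {φ : ModalForm}
    (h : NpA m n φ) (g : ModalForm → Prop) : (boxTranslate .and (settle m n) n m φ).Holds g := by
  obtain ⟨k, hk⟩ := exists_stage h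
  exact hk.holds_boxTranslate_of_lt hmn (fun j _ => Stage.exists_lt_of_box hmn hcon j)
    (fun j _ β hβ => holds_settle (.nec β hβ.toNpA) g)
    (fun j _ β hβ => not_holds_settle hcon (.rosbox β hβ.toNpA) g)

end NpA

/-- NpA enjoys the Lyndon interpolation property. -/
theorem NpA_LIP (m n : ℕ) (φ ψ : ModalForm) (h : NpA m n (.imp φ ψ)) :
    ∃ χ : ModalForm,
      χ.Vpos ⊆ φ.Vpos ∩ ψ.Vpos ∧ χ.Vneg ⊆ φ.Vneg ∩ ψ.Vneg ∧
      NpA m n (.imp φ χ) ∧ NpA m n (.imp χ ψ) := by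
  open ModalForm NpA in
  by_cases hcon : NpA m n .fls
  · exact ⟨.fls, by simp [Vpos, Vsgn], by simp [Vneg, Vsgn],
      of_holds₁ hcon fun _ h => h.elim, of_holds fun _ h => h.elim⟩
  rcases lt_or_ge m n with hmn | hnm
  · refine exists_interpolant_of_translation (T := boxTranslate .and (settle m n) n m)
      (Vsgn_boxTranslate_subset (fun _ _ _ => rfl) Vsgn_settle_subset n m)
      (iff_boxTranslate (fun φ χ γ δ hs h1 h2 => ?_) iff_settle) fun g => ?_
    · obtain ⟨-, ρ, rfl, rfl⟩ := exists_of_shorten hs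
      exact of_holds₃ (.amn ρ) h1 h2 fun g => by simp only [ModalForm.iff, Holds]; tauto
    · have h1 := holds_boxTranslate_of_lt hmn hcon h g
      rwa [boxTranslate] at h1
  · refine exists_interpolant_of_translation (T := boxTranslate .or (settle m n) m n)
      (Vsgn_boxTranslate_subset (fun _ _ _ => rfl) Vsgn_settle_subset m n)
      (iff_boxTranslate (fun φ χ γ δ hs h1 h2 => ?_) iff_settle) fun g => ?_
    · obtain ⟨-, ρ, rfl, rfl⟩ := exists_of_shorten hs
      exact of_holds₃ (.amn ρ) h1 h2 fun g => by simp only [ModalForm.iff, Holds]; tauto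
    · have h1 := holds_boxTranslate_of_le hnm h g
      rwa [boxTranslate] at h1
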